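/- Let Q > 1, y > 0, and ρ = σ + iγ ∈ ℂ, and set W_ρ(s) = ((Q^{(s−ρ)/2} − Q^{−(s−ρ)/2})/(s−ρ))², an entire function of s. Then for any c > σ: (1/(2πi))·∫_{Re(s)=c} y^s·W_ρ(s) ds equals y^ρ·log(Qy) if 1/Q < y < 1, equals y^ρ·log(Q/y) if 1 ≤ y < Q, and equals 0 if y ≤ 1/Q or y ≥ Q. Moreover, for any c > 1 − σ: (1/(2πi))·∫_{Re(s)=c} y^s·W_ρ(1−s) ds equals y^{1−ρ}·log(Qy) if 1/Q < y < 1, equals y^{1−ρ}·log(Q/y) if 1 ≤ y < Q, and equals 0 if y ≤ 1/Q or y ≥ Q. -/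

import Mathlib

open Complex Real Filter
open scoped ArithmeticFunction Classical

/-- The generalized Fejér kernel `W_ρ(s)` with parameter `Q`, with the removable
singularity at `s = ρ` filled in. -/
noncomputable def fejerWQ (Q : ℝ) (ρ s : ℂ) : ℂ :=
  if s = ρ then ((Real.log Q : ℝ) : ℂ) ^ 2
  else (((Q : ℂ) ^ ((s - ρ) / 2) - (Q : ℂ) ^ (-(s - ρ) / 2)) / (s - ρ)) ^ 2

/-- The vertical line integral `∫_{Re(s)=c} f(s) ds = ∫_ℝ f(c+it)·i dt`. -/
noncomputable def vlineIntegral (c : ℝ) (f : ℂ → ℂ) : ℂ :=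
  ∫ t : ℝ, f ((c : ℂ) + t * Complex.I) * Complex.I

/-- The tent function `max 0 (log Q - |log x|)`, whose Mellin transform is the Fejér kernel. -/
noncomputable def logTent (Q x : ℝ) : ℝ := max 0 (Real.log Q - |Real.log x|)

lemma logTent_eq_zero {Q x : ℝ} (hQ : 1 < Q) (hx : 0 < x) (h : x ≤ 1 / Q ∨ Q ≤ x) :
    logTent Q x = 0 := by
  rw [logTent, max_eq_left]
  rw [sub_nonpos]
  rcases h with h | h
  · have := Real.log_le_log hx h
    rw [one_div, Real.log_inv] at this
    exact le_trans (by linarith) (neg_le_abs _)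
  · exact (Real.log_le_log (by linarith) h).trans (le_abs_self _)

lemma logTent_eq_of_le_one {Q x : ℝ} (hQ : 1 < Q) (h : 1 / Q ≤ x) (h1 : x ≤ 1) :
    logTent Q x = Real.log Q + Real.log x := by
  have hQ0 : 0 < 1 / Q := by positivity
  have hlog := Real.log_le_log hQ0 h
  rw [one_div, Real.log_inv] at hlog
  rw [logTent, abs_of_nonpos (Real.log_nonpos (hQ0.le.trans h) h1), max_eq_right (by linarith)]
  ring

lemma logTent_eq_of_one_le {Q x : ℝ} (h1 : 1 ≤ x) (h : x ≤ Q) :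
    logTent Q x = Real.log Q - Real.log x := by
  have hlog := Real.log_le_log (by linarith) h
  rw [logTent, abs_of_nonneg (Real.log_nonneg h1), max_eq_right (by linarith)]

lemma logTent_inv (Q x : ℝ) : logTent Q x⁻¹ = logTent Q x := by
  simp [logTent]

lemma continuousAt_logTent (Q : ℝ) {x : ℝ} (hx : x ≠ 0) : ContinuousAt (logTent Q) x := by
  unfold logTent
  fun_prop (disch := assumption)

lemma mellinConvergent_logTent {Q : ℝ} (hQ : 1 < Q) (s : ℂ) :
    MellinConvergent (fun x => (logTent Q x : ℂ)) s := by
  have hcont : ContinuousOn (fun x : ℝ => (x : ℂ) ^ (s - 1) • (logTent Q x : ℂ))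
      (Set.Icc (1 / Q) Q) := by
    intro x hx
    have hx0 : x ≠ 0 := (lt_of_lt_of_le (by positivity) hx.1).ne'
    exact ((continuousAt_ofReal_cpow_const _ _ (Or.inr hx0)).smul
      (continuous_ofReal.continuousAt.comp (continuousAt_logTent Q hx0))).continuousWithinAt
  refine hcont.integrableOn_Icc.of_forall_sdiff_eq_zero measurableSet_Ioi fun x hx => ?_
  have hx0 : 0 < x := hx.1
  have : x ≤ 1 / Q ∨ Q ≤ x := by
    by_contra! hc
    exact hx.2 ⟨hc.1.le, hc.2.le⟩
  simp [logTent_eq_zero hQ hx0 this]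

lemma hasDerivAt_cpow_mul_add_log {z : ℂ} (hz : z ≠ 0) (a b : ℝ) {x : ℝ} (hx : 0 < x) :
    HasDerivAt (fun x : ℝ => (x : ℂ) ^ z * ((a + b * Real.log x : ℝ) : ℂ) / z
      - b * (x : ℂ) ^ z / z ^ 2)
      ((x : ℂ) ^ (z - 1) * ((a + b * Real.log x : ℝ) : ℂ)) x := by
  have hpow := hasDerivAt_ofReal_cpow_const hx.ne' hz
  have hlog := (((Real.hasDerivAt_log hx.ne').const_mul b).const_add a).ofReal_comp
  refine (((hpow.mul hlog).div_const z).sub ((hpow.const_mul (b : ℂ)).div_const _)).congr_deriv ?_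
  have hx0 : (x : ℂ) ≠ 0 := ofReal_ne_zero.mpr hx.ne'
  rw [cpow_sub _ _ hx0, cpow_one]
  push_cast
  field_simp
  ring

lemma intervalIntegral_cpow_mul_add_log {z : ℂ} (hz : z ≠ 0) (a b : ℝ) {u v : ℝ} (hu : 0 < u)
    (huv : u ≤ v) :
    ∫ x in u..v, (x : ℂ) ^ (z - 1) * ((a + b * Real.log x : ℝ) : ℂ) =
      ((v : ℂ) ^ z * ((a + b * Real.log v : ℝ) : ℂ) / z - b * (v : ℂ) ^ z / z ^ 2) -
      ((u : ℂ) ^ z * ((a + b * Real.log u : ℝ) : ℂ) / z - b * (u : ℂ) ^ z / z ^ 2) := by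
  have hpos : ∀ x ∈ Set.uIcc u v, 0 < x := fun x hx =>
    hu.trans_le (Set.uIcc_of_le huv ▸ hx).1
  refine intervalIntegral.integral_eq_sub_of_hasDerivAt
    (fun x hx => hasDerivAt_cpow_mul_add_log hz a b (hpos x hx)) ?_
  refine ContinuousOn.intervalIntegrable fun x hx => ContinuousAt.continuousWithinAt ?_
  have hx0 := (hpos x hx).ne'
  refine (continuousAt_ofReal_cpow_const _ _ (Or.inr hx0)).mul
    (continuous_ofReal.continuousAt.comp ?_)
  fun_prop (disch := assumption)

lemma mellin_logTent {Q : ℝ} (hQ : 1 < Q) {z : ℂ} (hz : z ≠ 0) :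
    mellin (fun x => (logTent Q x : ℂ)) z = ((Q : ℂ) ^ z + (Q : ℂ) ^ (-z) - 2) / z ^ 2 := by
  have hQ0 : 0 < Q := by linarith
  have hQ1 : 1 / Q ≤ 1 := by rw [div_le_one hQ0]; exact hQ.le
  have hQi : 0 < 1 / Q := by positivity
  have hconv := mellinConvergent_logTent hQ z
  have hii : ∀ u v : ℝ, 0 < u → u ≤ v → IntervalIntegrable
      (fun x : ℝ => (x : ℂ) ^ (z - 1) • (logTent Q x : ℂ)) MeasureTheory.volume u v := by
    intro u v hu huv
    rw [intervalIntegrable_iff_integrableOn_Ioc_of_le huv]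
    exact hconv.mono_set fun x hx => hu.trans hx.1
  have hsub : Set.Ioc (1 / Q) Q ⊆ Set.Ioi 0 := fun x hx => hQi.trans hx.1
  rw [mellin, MeasureTheory.setIntegral_eq_of_subset_of_forall_sdiff_eq_zero measurableSet_Ioi hsub,
    ← intervalIntegral.integral_of_le (hQ1.trans hQ.le),
    ← intervalIntegral.integral_add_adjacent_intervals (hii _ _ hQi hQ1) (hii _ _ one_pos hQ.le),
    intervalIntegral.integral_congr (a := 1 / Q)
      (g := fun x : ℝ => (x : ℂ) ^ (z - 1) * ((Real.log Q + 1 * Real.log x : ℝ) : ℂ)),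
    intervalIntegral.integral_congr (a := 1)
      (g := fun x : ℝ => (x : ℂ) ^ (z - 1) * ((Real.log Q + (-1) * Real.log x : ℝ) : ℂ)),
    intervalIntegral_cpow_mul_add_log hz _ _ hQi hQ1,
    intervalIntegral_cpow_mul_add_log hz _ _ one_pos hQ.le]
  · have : ((1 / Q : ℝ) : ℂ) ^ z = (Q : ℂ) ^ (-z) := by
      rw [cpow_neg, ← inv_cpow_ofReal_nonneg hQ0.le, one_div, ofReal_inv]
    rw [this]
    simp only [one_div, Real.log_inv, Real.log_one, ofReal_one, one_cpow]
    push_cast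
    field_simp
    ring
  · intro x hx
    rw [Set.uIcc_of_le hQ.le] at hx
    simp only [logTent_eq_of_one_le hx.1 hx.2, smul_eq_mul]
    ring_nf
  · intro x hx
    rw [Set.uIcc_of_le hQ1] at hx
    simp only [logTent_eq_of_le_one hQ hx.1 hx.2, smul_eq_mul, one_mul]
  · intro x hx
    have hx0 : 0 < x := hx.1
    have : x ≤ 1 / Q ∨ Q ≤ x := by
      by_contra! hc
      exact hx.2 ⟨hc.1, hc.2.le⟩
    simp [logTent_eq_zero hQ hx0 this]

lemma fejerWQ_eq_mellin {Q : ℝ} (hQ : 1 < Q) {ρ s : ℂ} (h : s ≠ ρ) :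
    fejerWQ Q ρ s = mellin (fun x => (logTent Q x : ℂ)) (s - ρ) := by
  have hQ0 : (Q : ℂ) ≠ 0 := ofReal_ne_zero.mpr (by linarith)
  rw [mellin_logTent hQ (sub_ne_zero.mpr h), fejerWQ, if_neg h, div_pow, sub_sq, ← cpow_nat_mul,
    ← cpow_nat_mul, mul_assoc, ← cpow_add _ _ hQ0]
  congr 1
  rw [show (s - ρ) / 2 + -(s - ρ) / 2 = 0 by ring, cpow_zero]
  push_cast
  rw [mul_div_cancel₀ _ two_ne_zero, mul_div_cancel₀ _ two_ne_zero]
  ring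

lemma integrable_inv_add_mul_I_sq {a : ℝ} (ha : 0 < a) :
    MeasureTheory.Integrable fun t : ℝ => (((a : ℂ) + t * Complex.I) ^ 2)⁻¹ := by
  have hne : ∀ t : ℝ, (a : ℂ) + t * Complex.I ≠ 0 := fun t h => by
    simpa [ha.ne'] using congrArg Complex.re h
  have hint := (integrable_inv_one_add_sq.comp_div ha.ne').const_mul (a ^ 2)⁻¹
  refine hint.mono' (Continuous.aestronglyMeasurable ?_) (Eventually.of_forall fun t => ?_)
  · exact Continuous.inv₀ (by fun_prop) fun t => pow_ne_zero _ (hne t)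
  · rw [norm_inv, norm_pow, Complex.sq_norm, normSq_add_mul_I, ← mul_inv]
    apply le_of_eq
    congr 1
    field_simp

lemma verticalIntegrable_mellin_logTent {Q : ℝ} (hQ : 1 < Q) {a : ℝ} (ha : 0 < a) :
    VerticalIntegrable (mellin fun x => (logTent Q x : ℂ)) a := by
  have hQ0 : 0 < Q := by linarith
  have hQ0' : (Q : ℂ) ≠ 0 := ofReal_ne_zero.mpr hQ0.ne'
  have hne : ∀ t : ℝ, (a : ℂ) + t * Complex.I ≠ 0 := fun t h => by
    simpa [ha.ne'] using congrArg Complex.re h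
  unfold VerticalIntegrable
  simp_rw [mellin_logTent hQ (hne _), div_eq_mul_inv]
  refine (integrable_inv_add_mul_I_sq ha).bdd_mul (c := Q ^ a + Q ^ (-a) + 2)
    (Continuous.aestronglyMeasurable ?_) (Eventually.of_forall fun t => ?_)
  · refine ((Continuous.const_cpow (by fun_prop) (Or.inl hQ0')).add
      (Continuous.const_cpow (by fun_prop) (Or.inl hQ0'))).sub continuous_const
  · refine (norm_sub_le _ _).trans (add_le_add ((norm_add_le _ _).trans (add_le_add ?_ ?_)) ?_)
    · simp [norm_cpow_eq_rpow_re_of_pos hQ0]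
    · simp [norm_cpow_eq_rpow_re_of_pos hQ0]
    · simp

lemma perron_vlineIntegral_fejerWQ {Q : ℝ} (hQ : 1 < Q) {y : ℝ} (hy : 0 < y) {ρ : ℂ} {c : ℝ}
    (hc : ρ.re < c) :
    1 / (2 * π * Complex.I) * vlineIntegral c (fun s => (y : ℂ) ^ s * fejerWQ Q ρ s) =
      (y : ℂ) ^ ρ * (logTent Q y : ℂ) := by
  have hy0 : (y : ℂ) ≠ 0 := ofReal_ne_zero.mpr hy.ne'
  have hpos : 0 < c - ρ.re := sub_pos.mpr hc
  have hinv := mellinInv_mellin_eq (c - ρ.re) (fun x => (logTent Q x : ℂ)) (inv_pos.mpr hy)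
    (mellinConvergent_logTent hQ _) (verticalIntegrable_mellin_logTent hQ hpos)
    (continuous_ofReal.continuousAt.comp (continuousAt_logTent Q (inv_pos.mpr hy).ne'))
  rw [logTent_inv] at hinv
  rw [← hinv, mellinInv, vlineIntegral, MeasureTheory.integral_mul_const,
    ← MeasureTheory.integral_add_right_eq_self _ ρ.im, real_smul]
  have hfun : ∀ t : ℝ, (y : ℂ) ^ ((c : ℂ) + ((t + ρ.im : ℝ) : ℂ) * Complex.I) *
      fejerWQ Q ρ ((c : ℂ) + ((t + ρ.im : ℝ) : ℂ) * Complex.I) =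
      (y : ℂ) ^ ρ * (((y⁻¹ : ℝ) : ℂ) ^ (-(((c - ρ.re : ℝ) : ℂ) + t * Complex.I)) •
        mellin (fun x => (logTent Q x : ℂ)) (((c - ρ.re : ℝ) : ℂ) + t * Complex.I)) := by
    intro t
    have hsub : (c : ℂ) + ((t + ρ.im : ℝ) : ℂ) * Complex.I - ρ =
        ((c - ρ.re : ℝ) : ℂ) + t * Complex.I := by
      apply Complex.ext <;> simp
    have hne : (c : ℂ) + ((t + ρ.im : ℝ) : ℂ) * Complex.I ≠ ρ := fun h => by
      have := congrArg Complex.re h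
      simp at this
      exact hc.ne' this
    rw [fejerWQ_eq_mellin hQ hne, hsub, ofReal_inv, inv_cpow_ofReal_nonneg hy.le, cpow_neg, inv_inv,
      smul_eq_mul, ← mul_assoc, ← cpow_add _ _ hy0, ← hsub, add_sub_cancel]
  simp_rw [hfun, MeasureTheory.integral_const_mul]
  generalize (∫ t : ℝ, (_ : ℂ)) = J
  push_cast
  field_simp

lemma fejerWQ_one_sub (Q : ℝ) (ρ s : ℂ) : fejerWQ Q ρ (1 - s) = fejerWQ Q (1 - ρ) s := by
  have hiff : 1 - s = ρ ↔ s = 1 - ρ := by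
    constructor <;> rintro rfl <;> ring
  unfold fejerWQ
  simp only [hiff]
  split_ifs with h
  · rfl
  · rw [show 1 - s - ρ = -(s - (1 - ρ)) by ring, neg_neg, div_neg, neg_sq, div_pow, div_pow,
      sub_sq_comm]

lemma perron_cases {Q : ℝ} (hQ : 1 < Q) {y : ℝ} (hy : 0 < y) {A B : ℂ}
    (h : A = B * (logTent Q y : ℂ)) :
    (1 / Q < y ∧ y < 1 → A = B * ((Real.log (Q * y) : ℝ) : ℂ)) ∧
    (1 ≤ y ∧ y < Q → A = B * ((Real.log (Q / y) : ℝ) : ℂ)) ∧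
    (y ≤ 1 / Q ∨ Q ≤ y → A = 0) := by
  have hQ0 : Q ≠ 0 := by positivity
  refine ⟨fun hy1 => ?_, fun hy1 => ?_, fun hy1 => ?_⟩
  · rw [h, logTent_eq_of_le_one hQ hy1.1.le hy1.2.le, Real.log_mul hQ0 hy.ne']
  · rw [h, logTent_eq_of_one_le hy1.1 hy1.2.le, Real.log_div hQ0 hy.ne']
  · rw [h, logTent_eq_zero hQ hy hy1, ofReal_zero, mul_zero]

/-- Perron-type formulas for the generalized Fejér kernel. -/
theorem fejer_kernel_perron (Q : ℝ) (hQ : 1 < Q) (y : ℝ) (hy : 0 < y) (ρ : ℂ) :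
    (∀ c : ℝ, ρ.re < c →
      ((1 / Q < y ∧ y < 1 →
          1 / (2 * π * Complex.I) *
              vlineIntegral c (fun s => (y : ℂ) ^ s * fejerWQ Q ρ s) =
            (y : ℂ) ^ ρ * ((Real.log (Q * y) : ℝ) : ℂ)) ∧
       (1 ≤ y ∧ y < Q →
          1 / (2 * π * Complex.I) *
              vlineIntegral c (fun s => (y : ℂ) ^ s * fejerWQ Q ρ s) =
            (y : ℂ) ^ ρ * ((Real.log (Q / y) : ℝ) : ℂ)) ∧
       (y ≤ 1 / Q ∨ Q ≤ y →
          1 / (2 * π * Complex.I) *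
              vlineIntegral c (fun s => (y : ℂ) ^ s * fejerWQ Q ρ s) = 0))) ∧
    (∀ c : ℝ, 1 - ρ.re < c →
      ((1 / Q < y ∧ y < 1 →
          1 / (2 * π * Complex.I) *
              vlineIntegral c (fun s => (y : ℂ) ^ s * fejerWQ Q ρ (1 - s)) =
            (y : ℂ) ^ (1 - ρ) * ((Real.log (Q * y) : ℝ) : ℂ)) ∧
       (1 ≤ y ∧ y < Q →
          1 / (2 * π * Complex.I) *
              vlineIntegral c (fun s => (y : ℂ) ^ s * fejerWQ Q ρ (1 - s)) =
            (y : ℂ) ^ (1 - ρ) * ((Real.log (Q / y) : ℝ) : ℂ)) ∧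
       (y ≤ 1 / Q ∨ Q ≤ y →
          1 / (2 * π * Complex.I) *
              vlineIntegral c (fun s => (y : ℂ) ^ s * fejerWQ Q ρ (1 - s)) = 0))) := by
  refine ⟨fun c hc => perron_cases hQ hy (perron_vlineIntegral_fejerWQ hQ hy hc), fun c hc => ?_⟩
  simp_rw [fejerWQ_one_sub]
  exact perron_cases hQ hy (perron_vlineIntegral_fejerWQ hQ hy (by simpa using hc))
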